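/- Let M₁, M₂ be nonnegative integers with M₁ + M₂ ≥ 1, and for each positive integer N let μ_{1,N},…,μ_{M₁+M₂,N} be permutations of [N]×[N] such that: (i) t∘μ_{k,N}∘t = μ_{k,N} for every k ≤ M₁, and 𝔧(μ_{k,N} : μ_{k,N})/N² → 0 for every M₁ < k ≤ M₁+M₂; (ii) for all a ≠ b, #{(i,j,k) ∈ [N]³ : μ_{a,N}(i,j) ∈ {μ_{b,N}(i,k), μ_{b,N}(k,j), (t∘μ_{b,N}∘t)(i,k), (t∘μ_{b,N}∘t)(k,j)}}/N² → 0. Let m be an even positive integer, f : [m] → [M₁+M₂], and ε : [m] → {1,∗} with ε(s) = 1 whenever f(s) ≤ M₁; set σ_{k,N} = μ_{f(k),N} if ε(k) = 1 and σ_{k,N} = t∘μ_{f(k),N}∘t if ε(k) = ∗. Then for every pair partition π of [m]: V_N(π,(σ_{1,N},…,σ_{m,N})) → 1 as N → ∞ if π ∈ NC₂^{f,ε}(m), and V_N(π,(σ_{1,N},…,σ_{m,N})) → 0 otherwise. -/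

import Mathlib

open Filter Topology

/-- The swap (transpose) map `t(a,b) = (b,a)` on pairs. -/
def swapPair {α : Type*} : α × α → α × α := fun p => (p.2, p.1)

/-- The conjugation `t ∘ μ ∘ t` of a permutation of pairs by the swap `t`. -/
def conjT {α : Type*} (μ : Equiv.Perm (α × α)) : Equiv.Perm (α × α) :=
  (Equiv.prodComm α α).trans (μ.trans (Equiv.prodComm α α))

/-- `C_N(π, σ⃗)`: the number of tuples `(i₁, …, i_m) ∈ [N]^m` (here `i : Fin m → α`)
such that `σ_k(i_k, i_{k+1}) = t(σ_{π(k)}(i_{π(k)}, i_{π(k)+1}))` for all `k`,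
indices read cyclically. -/
noncomputable def pairCount {α : Type*} (m : ℕ) (π : Equiv.Perm (Fin m))
    (σ : Fin m → Equiv.Perm (α × α)) : ℕ :=
  Nat.card {i : Fin m → α // ∀ k : Fin m,
    σ k (i k, i (finRotate m k)) = swapPair ((σ (π k)) (i (π k), i (finRotate m (π k))))}

/-- `V_N(π, σ⃗) = N^{-m/2-1} C_N(π, σ⃗)`. -/
noncomputable def Vval (m N : ℕ) (π : Equiv.Perm (Fin m))
    (σ : Fin m → Equiv.Perm (Fin N × Fin N)) : ℝ :=
  (pairCount m π σ : ℝ) / (N : ℝ) ^ (m / 2 + 1)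

/-- `𝔧(σ : τ) = #{(i,j,k) : σ(i,j) = (t∘τ∘t)(k,j)}`. -/
noncomputable def jcount {α : Type*} (σ τ : Equiv.Perm (α × α)) : ℕ :=
  Nat.card {x : α × α × α // σ (x.1, x.2.1) = (conjT τ) (x.2.2, x.2.1)}

/-- The count in condition (ii) of the main theorem:
`#{(i,j,k) : σ(i,j) ∈ {μ(i,k), μ(k,j), (t∘μ∘t)(i,k), (t∘μ∘t)(k,j)}}`. -/
noncomputable def mixCount {α : Type*} (σ μ : Equiv.Perm (α × α)) : ℕ :=
  Nat.card {x : α × α × α //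
    σ (x.1, x.2.1) = μ (x.1, x.2.2) ∨ σ (x.1, x.2.1) = μ (x.2.2, x.2.1) ∨
    σ (x.1, x.2.1) = conjT μ (x.1, x.2.2) ∨ σ (x.1, x.2.1) = conjT μ (x.2.2, x.2.1)}

/-- `𝔠(φ, ψ) = #{i : φ(i) = ψ(i)}`. -/
noncomputable def fixCount {α : Type*} (φ ψ : Equiv.Perm α) : ℕ := Nat.card {i : α // φ i = ψ i}

/-- The tuple `i` satisfies every constraint counted by `pairCount`. -/
def IsPairSolution {α : Type*} {m : ℕ} (π : Equiv.Perm (Fin m))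
    (σ : Fin m → Equiv.Perm (α × α)) (i : Fin m → α) : Prop :=
  ∀ k : Fin m,
    σ k (i k, i (finRotate m k)) = swapPair ((σ (π k)) (i (π k), i (finRotate m (π k))))

theorem pairCount_eq {α : Type*} {m : ℕ} (π : Equiv.Perm (Fin m))
    (σ : Fin m → Equiv.Perm (α × α)) :
    pairCount m π σ = Nat.card {i : Fin m → α // IsPairSolution π σ i} := rfl

theorem val_finRotate {m : ℕ} (k : Fin m) :
    (finRotate m k : ℕ) = if (k : ℕ) + 1 < m then (k : ℕ) + 1 else 0 := by
  obtain _ | n := m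
  · exact k.elim0
  · rw [coe_finRotate]
    have hk := k.isLt
    simp only [Fin.ext_iff, Fin.val_last]
    split_ifs <;> omega

/-- The position of `k` in the cyclic enumeration of `Fin m` that starts at `a`. -/
def cyclicRank {m : ℕ} (a k : Fin m) : ℕ :=
  if (a : ℕ) ≤ k then (k : ℕ) - a else m + k - a

theorem cyclicRank_lt {m : ℕ} (a k : Fin m) : cyclicRank a k < m := by
  have := a.isLt
  have := k.isLt
  unfold cyclicRank
  split_ifs <;> omega

theorem cyclicRank_self {m : ℕ} (a : Fin m) : cyclicRank a a = 0 := by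
  simp [cyclicRank]

theorem cyclicRank_injective {m : ℕ} (a : Fin m) : Function.Injective (cyclicRank a) := by
  intro k l h
  have := a.isLt
  have := k.isLt
  have := l.isLt
  unfold cyclicRank at h
  ext
  split_ifs at h <;> omega

theorem cyclicRank_finRotate {m : ℕ} (a k : Fin m) (h : cyclicRank a k + 1 < m) :
    cyclicRank a (finRotate m k) = cyclicRank a k + 1 := by
  have := a.isLt
  have := k.isLt
  unfold cyclicRank at h ⊢
  rw [val_finRotate]
  split_ifs at h ⊢ <;> omega

theorem exists_finRotate_eq_of_cyclicRank_eq_succ {m : ℕ} {a k : Fin m} {n : ℕ}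
    (h : cyclicRank a k = n + 1) : ∃ l, finRotate m l = k ∧ cyclicRank a l = n := by
  refine ⟨(finRotate m).symm k, Equiv.apply_symm_apply _ _, ?_⟩
  generalize hl : (finRotate m).symm k = l
  obtain rfl : k = finRotate m l := by rw [← hl, Equiv.apply_symm_apply]
  by_cases hlt : cyclicRank a l + 1 < m
  · rw [cyclicRank_finRotate a l hlt] at h
    omega
  · exfalso
    have := a.isLt
    have := l.isLt
    unfold cyclicRank at h hlt
    rw [val_finRotate] at h
    split_ifs at h hlt <;> omega

/-- The elements that precede their partner in the cyclic enumeration starting at `a`. -/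
def openers {m : ℕ} (π : Equiv.Perm (Fin m)) (a : Fin m) : Finset (Fin m) :=
  Finset.univ.filter fun k => cyclicRank a k < cyclicRank a (π k)

theorem mem_openers {m : ℕ} {π : Equiv.Perm (Fin m)} {a k : Fin m} :
    k ∈ openers π a ↔ cyclicRank a k < cyclicRank a (π k) := by
  simp [openers]

theorem cyclicRank_lt_of_notMem_openers {m : ℕ} {π : Equiv.Perm (Fin m)} {a k : Fin m}
    (hfix : ∀ k, π k ≠ k) (hk : k ∉ openers π a) : cyclicRank a (π k) < cyclicRank a k :=
  lt_of_le_of_ne (not_lt.1 (mt mem_openers.2 hk))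
    fun h => hfix k (cyclicRank_injective a h)

theorem self_mem_openers {m : ℕ} {π : Equiv.Perm (Fin m)} (hfix : ∀ k, π k ≠ k) (a : Fin m) :
    a ∈ openers π a := by
  rw [mem_openers, cyclicRank_self, Nat.pos_iff_ne_zero, ← cyclicRank_self a]
  exact fun h => hfix a (cyclicRank_injective a h)

theorem card_openers {m : ℕ} {π : Equiv.Perm (Fin m)} (hinv : ∀ k, π (π k) = k)
    (hfix : ∀ k, π k ≠ k) (a : Fin m) : (openers π a).card = m / 2 := by
  have hcompl : (openers π a)ᶜ = (openers π a).map π.toEmbedding := by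
    ext k
    simp only [Finset.mem_compl, Finset.mem_map_equiv]
    have hsymm : π.symm k = π k := by rw [Equiv.symm_apply_eq, hinv]
    rw [hsymm, mem_openers, mem_openers, hinv]
    have hne : cyclicRank a (π k) ≠ cyclicRank a k :=
      fun h => hfix k (cyclicRank_injective a h)
    omega
  have h := Finset.card_add_card_compl (openers π a)
  rw [hcompl, Finset.card_map, Fintype.card_fin] at h
  omega

/-- Exploring the cycle from `a`, a solution is determined by its value at `a` and by the values
at the end points of the opening edges. -/
theorem IsPairSolution.ext_openers {α : Type*} {m : ℕ} {π : Equiv.Perm (Fin m)}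
    {σ : Fin m → Equiv.Perm (α × α)} (hfix : ∀ k, π k ≠ k) {i i' : Fin m → α}
    (hi : IsPairSolution π σ i) (hi' : IsPairSolution π σ i') (a : Fin m) (ha : i a = i' a)
    (h : ∀ k ∈ openers π a, i (finRotate m k) = i' (finRotate m k)) : i = i' := by
  have key : ∀ n, ∀ k, cyclicRank a k = n → i k = i' k := by
    intro n
    induction n using Nat.strong_induction_on with
    | _ n ih =>
      intro k hk
      obtain _ | n := n
      · rwa [cyclicRank_injective a (hk.trans (cyclicRank_self a).symm)]
      · obtain ⟨l, rfl, hl⟩ := exists_finRotate_eq_of_cyclicRank_eq_succ hk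
        by_cases hlo : l ∈ openers π a
        · exact h l hlo
        · have hlt := cyclicRank_lt_of_notMem_openers hfix hlo
          have hlm := cyclicRank_lt a l
          have h1 : i (π l) = i' (π l) := ih _ (by omega) _ rfl
          have h2 : i (finRotate m (π l)) = i' (finRotate m (π l)) :=
            ih _ (by rw [cyclicRank_finRotate a (π l) (by omega)]; omega) _ rfl
          have h3 := hi l
          rw [h1, h2, ← hi' l] at h3
          exact congrArg Prod.snd ((σ l).injective h3)
  exact funext fun k => key _ k rfl

/-- The values along the cycle, as a function of a natural number. -/
def cyclicValue {α : Type*} {m : ℕ} [NeZero m] (i : Fin m → α) (j : ℕ) : α := i (Fin.ofNat m j)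

theorem cyclicValue_val {α : Type*} {m : ℕ} [NeZero m] (i : Fin m → α) (k : Fin m) :
    cyclicValue i k = i k := by
  simp [cyclicValue]

theorem cyclicValue_val_add_one {α : Type*} {m : ℕ} [NeZero m] (i : Fin m → α) (k : Fin m) :
    cyclicValue i (k + 1) = i (finRotate m k) := by
  unfold cyclicValue
  congr 1
  ext
  rw [val_finRotate, Fin.val_ofNat]
  have := k.isLt
  split_ifs with h
  · exact Nat.mod_eq_of_lt h
  · rw [show (k : ℕ) + 1 = m by omega, Nat.mod_self]

/-- The interval spanned by `x` and `π x` is stable under `π`. -/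
def IsClosedAt {m : ℕ} (π : Equiv.Perm (Fin m)) (x : Fin m) : Prop :=
  ∀ y, x < y → y < π x → x < π y ∧ π y < π x

theorem noncrossing_iff_forall_isClosedAt {m : ℕ} {π : Equiv.Perm (Fin m)}
    (hinv : ∀ k, π (π k) = k) :
    (∀ a b : Fin m, ¬(a < b ∧ b < π a ∧ π a < π b)) ↔ ∀ x, x < π x → IsClosedAt π x := by
  constructor
  · intro h x _ y hxy hyx
    have hx : π y ≠ x := by
      rintro rfl
      rw [hinv] at hyx
      exact lt_irrefl _ hyx
    have hy : π y ≠ π x := fun e => hxy.ne' (π.injective e)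
    constructor
    · by_contra hlt
      exact h (π y) x ⟨lt_of_le_of_ne (not_lt.1 hlt) hx, by rwa [hinv], by rwa [hinv]⟩
    · by_contra hlt
      exact h x y ⟨hxy, hyx, lt_of_le_of_ne (not_lt.1 hlt) hy.symm⟩
  · rintro h a b ⟨hab, hba, hlt⟩
    exact absurd (h a (hab.trans hba) b hab hba).2 hlt.not_gt

/-- A walk that closes up along each nested pair returns to its start along a `π`-stable
interval. -/
theorem eq_of_stable_interval {α : Type*} {m : ℕ} {π : Equiv.Perm (Fin m)}
    (hinv : ∀ k, π (π k) = k) (hfix : ∀ k, π k ≠ k) (v : ℕ → α) (l h : ℕ) (hlh : l ≤ h)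
    (hm : h ≤ m)
    (hstable : ∀ x : Fin m, l ≤ x → (x : ℕ) < h → l ≤ π x ∧ (π x : ℕ) < h)
    (hpair : ∀ x : Fin m, l ≤ x → x < π x → (π x : ℕ) < h →
      IsClosedAt π x ∧ (v (x + 1) = v (π x) → v x = v (π x + 1))) :
    v l = v h := by
  induction hn : h - l using Nat.strong_induction_on generalizing l h with
  | _ n ih =>
    subst hn
    obtain rfl | hlt := hlh.eq_or_lt
    · rfl
    · obtain ⟨x, rfl⟩ : ∃ x : Fin m, (x : ℕ) = l := ⟨⟨l, by omega⟩, rfl⟩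
      have hx := hstable x le_rfl hlt
      have hne : (π x : ℕ) ≠ x := fun e => hfix x (Fin.ext e)
      obtain ⟨hclosed, hv⟩ := hpair x le_rfl (Fin.lt_def.2 (by omega)) hx.2
      simp only [IsClosedAt, Fin.lt_def] at hclosed
      have hinner : v (x + 1) = v (π x) := by
        refine ih _ (by omega) _ _ (by omega) (by omega) (fun y h1 h2 => ?_)
          (fun y h1 h2 h3 => hpair y (by omega) h2 (by omega)) rfl
        have := hclosed y (by omega) h2
        omega
      rw [hv hinner]
      refine ih _ (by omega) _ _ (by omega) hm (fun y h1 h2 => ⟨?_, ?_⟩)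
          (fun y h1 h2 h3 => hpair y (by omega) h2 (by omega)) rfl
      · have h3 := hstable y (by omega) h2
        have h4 : (π y : ℕ) ≠ π x := fun e => by
          have := π.injective (Fin.ext e)
          subst this
          omega
        have h5 : (π y : ℕ) ≠ x := fun e => by
          have h6 : π x = y := by rw [← hinv y, Fin.ext e]
          rw [h6] at h1
          omega
        by_contra h6
        have h7 := hclosed (π y) (by omega) (by omega)
        rw [hinv] at h7
        omega
      · exact (hstable y (by omega) h2).2

theorem conjT_conjT {α : Type*} (μ : Equiv.Perm (α × α)) : conjT (conjT μ) = μ := by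
  ext x <;> simp [conjT]

theorem conjT_apply {α : Type*} (μ : Equiv.Perm (α × α)) (x y : α) :
    conjT μ (x, y) = swapPair (μ (y, x)) := rfl

theorem swapPair_injective {α : Type*} : Function.Injective (swapPair (α := α)) := by
  rintro ⟨a, b⟩ ⟨c, d⟩ h
  simp only [swapPair, Prod.mk.injEq] at h
  exact Prod.ext h.2 h.1

theorem IsPairSolution.eq_of_conjT {α : Type*} {m : ℕ} {π : Equiv.Perm (Fin m)}
    {σ : Fin m → Equiv.Perm (α × α)} {i : Fin m → α} (hi : IsPairSolution π σ i) {x : Fin m}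
    (hx : σ x = conjT (σ (π x))) : i x = i (finRotate m (π x)) := by
  have h := hi x
  rw [← conjT_apply, ← hx] at h
  exact congrArg Prod.fst ((σ x).injective h)

/-- A solution closes up along a stable interval all of whose nested pairs are conjugate. -/
theorem IsPairSolution.apply_finRotate_eq {α : Type*} {m : ℕ}
    {π : Equiv.Perm (Fin m)} {σ : Fin m → Equiv.Perm (α × α)} (hinv : ∀ k, π (π k) = k)
    (hfix : ∀ k, π k ≠ k) {i : Fin m → α} (hi : IsPairSolution π σ i) {a b : Fin m} (hab : a < b)
    (hstable : ∀ x, a < x → x < b → a < π x ∧ π x < b)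
    (hpair : ∀ x, a < x → x < π x → π x < b → IsClosedAt π x ∧ σ x = conjT (σ (π x))) :
    i (finRotate m a) = i b := by
  have : NeZero m := ⟨by have := a.isLt; omega⟩
  rw [← cyclicValue_val_add_one i a, ← cyclicValue_val i b]
  refine eq_of_stable_interval hinv hfix _ _ _ hab b.isLt.le
    (fun x h1 h2 => hstable x h1 h2) fun x h1 h2 h3 => ?_
  obtain ⟨h4, h5⟩ := hpair x h1 h2 h3
  refine ⟨h4, fun _ => ?_⟩
  rw [cyclicValue_val, cyclicValue_val_add_one]
  exact hi.eq_of_conjT h5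

/-- Extends values prescribed at the end points of opening edges to a walk that backtracks along
closing edges. -/
def backtrackWalk {α : Type*} (p : ℕ → ℕ) (g : ℕ → α) : ℕ → α
  | 0 => g 0
  | k + 1 => if p k < k then backtrackWalk p g (p k) else g (k + 1)
termination_by k => k

theorem card_option_finset_fun {α : Type*} {m : ℕ} (s : Finset (Fin m)) :
    Nat.card (Option s → α) = Nat.card α ^ (s.card + 1) := by
  rw [Nat.card_fun]
  simp

section Counting

variable {α : Type*} [Finite α] {m : ℕ} {π : Equiv.Perm (Fin m)}
  {σ : Fin m → Equiv.Perm (α × α)}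

theorem pairCount_le (hinv : ∀ k, π (π k) = k) (hfix : ∀ k, π k ≠ k) (hm0 : 0 < m) :
    pairCount m π σ ≤ Nat.card α ^ (m / 2 + 1) := by
  let a : Fin m := ⟨0, hm0⟩
  rw [pairCount_eq, ← card_openers hinv hfix a, ← card_option_finset_fun]
  refine Nat.card_le_card_of_injective
    (fun i o => o.elim (i.1 a) fun k => i.1 (finRotate m k)) fun i i' h => ?_
  exact Subtype.ext (i.2.ext_openers hfix i'.2 a (congrFun h none)
    fun k hk => congrFun h (some ⟨k, hk⟩))

theorem le_pairCount (hinv : ∀ k, π (π k) = k) (hfix : ∀ k, π k ≠ k) (hm0 : 0 < m)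
    (hclosed : ∀ x, x < π x → IsClosedAt π x) (hσ : ∀ x, σ x = conjT (σ (π x))) :
    Nat.card α ^ (m / 2 + 1) ≤ pairCount m π σ := by
  have : NeZero m := ⟨hm0.ne'⟩
  let a : Fin m := ⟨0, hm0⟩
  have hrank : ∀ k : Fin m, cyclicRank a k = k := fun k => by simp [cyclicRank, a]
  let p : ℕ → ℕ := fun k => π (Fin.ofNat m k)
  have hp : ∀ k : Fin m, p k = π k := fun k => by simp [p]
  classical
  let endVal : (Option (openers π a) → α) → ℕ → α := fun g k =>
    if h : ∃ l : openers π a, (l : ℕ) + 1 = k then g (some h.choose) else g none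
  have hendVal0 : ∀ g, endVal g 0 = g none := fun g => by simp [endVal]
  have hendVal : ∀ g (l : openers π a), endVal g (l + 1) = g (some l) := fun g l => by
    have h : ∃ l' : openers π a, (l' : ℕ) + 1 = (l : ℕ) + 1 := ⟨l, rfl⟩
    have h2 : h.choose = l := Subtype.ext (Fin.ext (Nat.succ_injective h.choose_spec))
    simp only [endVal, dif_pos h, h2]
  let w : (Option (openers π a) → α) → ℕ → α := fun g => backtrackWalk p (endVal g)
  have hw0 : ∀ g, w g 0 = g none := fun g => by simp only [w, backtrackWalk, hendVal0]
  have hwo : ∀ g (l : openers π a), w g (l + 1) = g (some l) := fun g l => by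
    have hl := mem_openers.1 l.2
    rw [hrank, hrank] at hl
    simp only [w, backtrackWalk, hp, hendVal]
    exact if_neg hl.not_gt
  have hwc : ∀ g (k : Fin m), π k < k → w g (k + 1) = w g (π k) := fun g k hk => by
    simp only [w]
    rw [backtrackWalk, hp]
    exact if_pos hk
  have hback : ∀ g (x : Fin m), x < π x → w g x = w g (π x + 1) := fun g x hx => by
    rw [hwc g (π x) (by rwa [hinv]), hinv]
  have hinner : ∀ g (x : Fin m), x < π x → w g (x + 1) = w g (π x) := fun g x hx => by
    refine eq_of_stable_interval hinv hfix (w g) _ _ hx (π x).isLt.le (fun y h1 h2 => ?_)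
      fun y _ hy _ => ⟨hclosed y hy, fun _ => hback g y hy⟩
    have := hclosed x hx y h1 h2
    exact ⟨this.1, this.2⟩
  have hwm : ∀ g, w g m = w g 0 := fun g =>
    (eq_of_stable_interval hinv hfix (w g) 0 m (Nat.zero_le _) le_rfl
      (fun y _ _ => ⟨Nat.zero_le _, (π y).isLt⟩)
      fun y _ hy _ => ⟨hclosed y hy, fun _ => hback g y hy⟩).symm
  have hrot : ∀ g (k : Fin m), w g (finRotate m k) = w g (k + 1) := fun g k => by
    rw [val_finRotate]
    split_ifs with h
    · rfl
    · rw [show (k : ℕ) + 1 = m by omega, hwm]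
  have hstep : ∀ g (k : Fin m), w g k = w g (π k + 1) ∧ w g (k + 1) = w g (π k) := by
    intro g k
    obtain h | h := lt_or_gt_of_ne (hfix k)
    · refine ⟨?_, hwc g k h⟩
      have := hinner g (π k) (by rwa [hinv])
      rw [hinv] at this
      exact this.symm
    · exact ⟨hback g k h, hinner g k h⟩
  have hsol : ∀ g, IsPairSolution π σ fun k => w g k := by
    intro g k
    rw [← conjT_apply, ← hσ]
    simp only [hrot]
    rw [← (hstep g k).1, (hstep g k).2]
  rw [pairCount_eq, ← card_openers hinv hfix a, ← card_option_finset_fun]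
  refine Nat.card_le_card_of_injective (fun g => ⟨_, hsol g⟩) fun g g' h => ?_
  have h' : ∀ k : Fin m, w g k = w g' k := fun k => congrFun (congrArg Subtype.val h) k
  funext o
  obtain _ | l := o
  · rw [← hw0 g, ← hw0 g']
    exact h' a
  · rw [← hwo g, ← hwo g', ← hrot, ← hrot, h']

theorem pairCount_le_jcount_mul (hinv : ∀ k, π (π k) = k) (hfix : ∀ k, π k ≠ k) {a : Fin m}
    (ha : a < π a) (hclosed : IsClosedAt π a)
    (hpair : ∀ x, a < x → x < π x → π x < π a → IsClosedAt π x ∧ σ x = conjT (σ (π x))) :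
    pairCount m π σ ≤ jcount (σ a) (σ (π a)) * Nat.card α ^ (m / 2 - 1) := by
  have hcard : Nat.card ((openers π a).erase a → α) = Nat.card α ^ (m / 2 - 1) := by
    rw [Nat.card_fun, Nat.card_eq_fintype_card (α := (openers π a).erase a), Fintype.card_coe,
      Finset.card_erase_of_mem (self_mem_openers hfix a), card_openers hinv hfix]
  rw [pairCount_eq, jcount, ← hcard, ← Nat.card_prod]
  have hmem : ∀ i : {i : Fin m → α // IsPairSolution π σ i},
      σ a (i.1 a, i.1 (finRotate m a)) =
        conjT (σ (π a)) (i.1 (finRotate m (π a)), i.1 (finRotate m a)) := fun i => by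
    rw [conjT_apply]
    conv_rhs => rw [i.2.apply_finRotate_eq hinv hfix ha hclosed hpair]
    exact i.2 a
  refine Nat.card_le_card_of_injective
    (fun i => (⟨(i.1 a, i.1 (finRotate m a), i.1 (finRotate m (π a))), hmem i⟩,
      fun k => i.1 (finRotate m k))) fun i i' h => ?_
  simp only [Prod.mk.injEq, Subtype.mk.injEq] at h
  obtain ⟨⟨h1, h2, -⟩, h3⟩ := h
  refine Subtype.ext (i.2.ext_openers hfix i'.2 a h1 fun k hk => ?_)
  by_cases hka : k = a
  · rwa [hka]
  · exact congrFun h3 ⟨k, Finset.mem_erase.2 ⟨hka, hk⟩⟩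

theorem pairCount_le_of_not_isClosedAt (hinv : ∀ k, π (π k) = k) (hfix : ∀ k, π k ≠ k)
    {a : Fin m} (hclosed : ¬ IsClosedAt π a)
    (hpair : ∀ x, a < x → x < π x → π x < π a → IsClosedAt π x ∧ σ x = conjT (σ (π x))) :
    pairCount m π σ ≤ Nat.card α ^ (m / 2) := by
  classical
  let s : Finset (Fin m) :=
    Finset.univ.filter fun y => a < y ∧ y < π a ∧ ¬ (a < π y ∧ π y < π a)
  have hs : s.Nonempty := by
    simp only [IsClosedAt, not_forall] at hclosed
    obtain ⟨y, h1, h2, h3⟩ := hclosed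
    exact ⟨y, by simp only [s, Finset.mem_filter, Finset.mem_univ, true_and]; exact ⟨h1, h2, h3⟩⟩
  obtain ⟨c, hcs, hmax⟩ := s.exists_max_image id hs
  simp only [s, Finset.mem_filter, Finset.mem_univ, true_and, id] at hcs hmax
  obtain ⟨hac, hcb, hc⟩ := hcs
  have hca : π c ≠ a := fun e => by
    rw [← e, hinv] at hcb
    exact lt_irrefl _ hcb
  have hstable : ∀ y, c < y → y < π a → c < π y ∧ π y < π a := by
    intro y h1 h2
    have h3 : a < π y ∧ π y < π a := by
      by_contra h3
      exact absurd (hmax y ⟨hac.trans h1, h2, h3⟩) h1.not_ge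
    refine ⟨?_, h3.2⟩
    by_contra h4
    obtain h5 | h5 := (not_lt.1 h4).eq_or_lt
    · rw [← h5, hinv] at hc
      exact hc ⟨hac.trans h1, h2⟩
    · have h6 := (hpair (π y) h3.1 (by rw [hinv]; exact h5.trans h1) (by rwa [hinv])).1 c h5
        (by rwa [hinv])
      rw [hinv] at h6
      exact hc ⟨h3.1.trans h6.1, h6.2.trans h2⟩
  have hco : c ∈ openers π a := by
    rw [mem_openers]
    unfold cyclicRank
    have h1 : (π c : ℕ) ≠ a := fun e => hca (Fin.ext e)
    simp only [Fin.lt_def] at hac hcb hc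
    have := (π a).isLt
    have := a.isLt
    split_ifs <;> omega
  have hcard : Nat.card (Option ((openers π a).erase c) → α) = Nat.card α ^ (m / 2) := by
    rw [card_option_finset_fun, Finset.card_erase_add_one hco, card_openers hinv hfix]
  rw [pairCount_eq, ← hcard]
  refine Nat.card_le_card_of_injective
    (fun i o => o.elim (i.1 a) fun k => i.1 (finRotate m k)) fun i i' h => ?_
  have h0 : i.1 a = i'.1 a := congrFun h none
  have h1 : ∀ k ∈ openers π a, k ≠ c → i.1 (finRotate m k) = i'.1 (finRotate m k) :=
    fun k hk hkc => congrFun h (some ⟨k, Finset.mem_erase.2 ⟨hkc, hk⟩⟩)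
  refine Subtype.ext (i.2.ext_openers hfix i'.2 a h0 fun k hk => ?_)
  by_cases hkc : k = c
  · subst hkc
    have hclose : ∀ j : {i : Fin m → α // IsPairSolution π σ i},
        j.1 (finRotate m k) = j.1 (π a) := fun j =>
      j.2.apply_finRotate_eq hinv hfix hcb hstable
        fun x h1 h2 h3 => hpair x (hac.trans h1) h2 h3
    rw [hclose, hclose]
    have h2 := i.2 a
    rw [h0, h1 a (self_mem_openers hfix a) hac.ne, i'.2 a] at h2
    exact congrArg Prod.fst ((σ (π a)).injective (swapPair_injective h2.symm))
  · exact h1 k hk hkc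

end Counting

section Conjugation

variable {α : Type*} (μ ν : Equiv.Perm (α × α))

theorem jcount_conjT_conjT : jcount (conjT μ) (conjT μ) = jcount μ μ := by
  refine Nat.card_congr
    { toFun := fun x => ⟨(x.1.2.2, x.1.2.1, x.1.1), ?_⟩
      invFun := fun x => ⟨(x.1.2.2, x.1.2.1, x.1.1), ?_⟩
      left_inv := fun _ => rfl
      right_inv := fun _ => rfl }
  · exact x.2.symm
  · exact x.2.symm

theorem jcount_le_mixCount [Finite α] (e e' : Bool) :
    jcount (if e then conjT μ else μ) (if e' then conjT ν else ν) ≤ mixCount μ ν := by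
  cases e
  · refine Nat.card_le_card_of_injective (fun x => ⟨x.1, ?_⟩)
      fun x y h => Subtype.ext (Subtype.mk.inj h)
    have := x.2
    cases e'
    · exact Or.inr (Or.inr (Or.inr this))
    · simp only [if_true, conjT_conjT] at this
      exact Or.inr (Or.inl this)
  · refine Nat.card_le_card_of_injective (fun x => ⟨(x.1.2.1, x.1.1, x.1.2.2), ?_⟩)
      fun x y h => ?_
    · have := x.2
      cases e'
      · exact Or.inl (swapPair_injective this)
      · simp only [if_true, conjT_conjT] at this
        exact Or.inr (Or.inr (Or.inl (congrArg swapPair this)))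
    · simp only [Subtype.mk.injEq, Prod.mk.injEq] at h
      exact Subtype.ext (Prod.ext h.2.1 (Prod.ext h.1 h.2.2))

end Conjugation


/-- let `μ_{1,N}, …, μ_{M₁+M₂,N}` be permutations of `[N]²` such that
(i) `μ_{k,N}` is symmetric (`t∘μ_{k,N}∘t = μ_{k,N}`) for `k ≤ M₁` and
`𝔧(μ_{k,N} : μ_{k,N})/N² → 0` for `M₁ < k ≤ M₁+M₂`, and (ii) for `a ≠ b` the
count `#{(i,j,k) : μ_{a,N}(i,j) ∈ {μ_{b,N}(i,k), μ_{b,N}(k,j), (t∘μ_{b,N}∘t)(i,k),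
(t∘μ_{b,N}∘t)(k,j)}}` is `o(N²)`. Let `f : [m] → [M₁+M₂]`, `ε : [m] → {1,∗}`
(`false = 1`, `true = ∗`) with `ε(s) = 1` whenever `f(s) ≤ M₁`, and set
`σ_{k,N} = μ_{f(k),N}` if `ε k = 1`, `σ_{k,N} = t∘μ_{f(k),N}∘t` if `ε k = ∗`.
Then for every pair partition `π` of `[m]`: `V_N(π,σ⃗_N) → 1` if
`π ∈ NC₂^{f,ε}(m)` and `V_N(π,σ⃗_N) → 0` otherwise. -/
theorem Vval_limit_family (M₁ M₂ : ℕ) (hM : 1 ≤ M₁ + M₂)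
    (μ : ∀ N : ℕ, Fin (M₁ + M₂) → Equiv.Perm (Fin N × Fin N))
    (hsym : ∀ k : Fin (M₁ + M₂), (k : ℕ) < M₁ → ∀ N, conjT (μ N k) = μ N k)
    (hj : ∀ k : Fin (M₁ + M₂), M₁ ≤ (k : ℕ) →
      Tendsto (fun N : ℕ => (jcount (μ N k) (μ N k) : ℝ) / (N : ℝ) ^ 2) atTop (nhds 0))
    (hmix : ∀ a b : Fin (M₁ + M₂), a ≠ b →
      Tendsto (fun N : ℕ => (mixCount (μ N a) (μ N b) : ℝ) / (N : ℝ) ^ 2) atTop (nhds 0))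
    (m : ℕ) (hm : Even m) (hm0 : 0 < m)
    (f : Fin m → Fin (M₁ + M₂)) (ε : Fin m → Bool)
    (hε : ∀ s : Fin m, (f s : ℕ) < M₁ → ε s = false)
    (π : Equiv.Perm (Fin m)) (hinv : ∀ k, π (π k) = k) (hfix : ∀ k, π k ≠ k) :
    (((∀ a b : Fin m, ¬(a < b ∧ b < π a ∧ π a < π b)) ∧ (∀ s, f s = f (π s)) ∧
        ∀ s : Fin m, M₁ ≤ (f s : ℕ) → ε s ≠ ε (π s)) →
      Tendsto (fun N : ℕ => Vval m N π
          (fun k => if ε k then conjT (μ N (f k)) else μ N (f k))) atTop (nhds 1)) ∧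
    (¬((∀ a b : Fin m, ¬(a < b ∧ b < π a ∧ π a < π b)) ∧ (∀ s, f s = f (π s)) ∧
        ∀ s : Fin m, M₁ ≤ (f s : ℕ) → ε s ≠ ε (π s)) →
      Tendsto (fun N : ℕ => Vval m N π
          (fun k => if ε k then conjT (μ N (f k)) else μ N (f k))) atTop (nhds 0)) := by
  set σ : ∀ N, Fin m → Equiv.Perm (Fin N × Fin N) :=
    fun N k => if ε k then conjT (μ N (f k)) else μ N (f k) with hσdef
  let Good : Fin m → Prop := fun s => f s = f (π s) ∧ (M₁ ≤ (f s : ℕ) → ε s ≠ ε (π s))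
  have hgood : ∀ s, Good s → ∀ N, σ N s = conjT (σ N (π s)) := by
    rintro s ⟨h1, h2⟩ N
    by_cases hs : M₁ ≤ (f s : ℕ)
    · have h3 := h2 hs
      simp only [hσdef, ← h1]
      cases h4 : ε s <;> cases h5 : ε (π s) <;> simp_all [conjT_conjT]
    · have h3 : (f s : ℕ) < M₁ := not_le.1 hs
      simp [hσdef, ← h1, hε s h3, hε (π s) (h1 ▸ h3), hsym _ h3 N]
  have hbad : ∀ s, ¬ Good s →
      Tendsto (fun N : ℕ => (jcount (σ N s) (σ N (π s)) : ℝ) / (N : ℝ) ^ 2) atTop (nhds 0) := by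
    intro s hs
    by_cases h1 : f s = f (π s)
    · have h2 : M₁ ≤ (f s : ℕ) ∧ ε s = ε (π s) := by
        simpa [Good, h1] using hs
      convert hj (f s) h2.1 using 4 with N
      simp only [hσdef, ← h1, ← h2.2]
      cases ε s
      · rfl
      · exact jcount_conjT_conjT _
    · refine squeeze_zero (fun N => by positivity) (fun N => ?_) (hmix _ _ h1)
      have := jcount_le_mixCount (μ N (f s)) (μ N (f (π s))) (ε s) (ε (π s))
      gcongr
  have hiff : ((∀ a b : Fin m, ¬(a < b ∧ b < π a ∧ π a < π b)) ∧ (∀ s, f s = f (π s)) ∧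
        ∀ s : Fin m, M₁ ≤ (f s : ℕ) → ε s ≠ ε (π s)) ↔
      ∀ x, x < π x → IsClosedAt π x ∧ Good x := by
    rw [noncrossing_iff_forall_isClosedAt hinv, ← forall_and]
    constructor
    · exact fun h x hx => ⟨h.1 x hx, h.2 x⟩
    · refine fun h => ⟨fun x hx => (h x hx).1, fun x => ?_⟩
      obtain hx | hx := lt_or_gt_of_ne (hfix x)
      · obtain ⟨-, h1, h2⟩ := h (π x) (by rwa [hinv])
        rw [hinv] at h1 h2
        exact ⟨h1.symm, fun h3 => (h2 (h1 ▸ h3)).symm⟩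
      · exact (h x hx).2
  rw [hiff]
  constructor
  · intro h
    have hall : ∀ x, Good x := fun x =>
      ⟨(hiff.2 h).2.1 x, (hiff.2 h).2.2 x⟩
    refine tendsto_const_nhds.congr' ?_
    filter_upwards [eventually_gt_atTop 0] with N hN
    have hcount : pairCount m π (σ N) = N ^ (m / 2 + 1) := by
      have hle := pairCount_le (σ := σ N) hinv hfix hm0
      have hge := le_pairCount (σ := σ N) hinv hfix hm0 (fun x hx => (h x hx).1)
        fun x => hgood x (hall x) N
      rw [Nat.card_fin] at hle hge
      exact le_antisymm hle hge
    rw [Vval, hcount, Nat.cast_pow, div_self (by positivity)]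
  · intro h
    obtain ⟨a, ⟨ha, hna⟩, hmin⟩ := Set.exists_min_image
      {x : Fin m | x < π x ∧ ¬ (IsClosedAt π x ∧ Good x)} (fun x => (π x : ℕ) - x)
      (Set.toFinite _)
      (by simpa only [not_forall, exists_prop, Set.Nonempty, Set.mem_ofPred_eq] using h)
    have hpair : ∀ N x, a < x → x < π x → π x < π a →
        IsClosedAt π x ∧ σ N x = conjT (σ N (π x)) := by
      intro N x h1 h2 h3
      have h4 : IsClosedAt π x ∧ Good x := by
        by_contra h4
        have h5 := hmin x ⟨h2, h4⟩
        simp only [Fin.lt_def] at h1 h2 h3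
        omega
      exact ⟨h4.1, hgood x h4.2 N⟩
    have hm2 : 0 < m / 2 := by
      obtain ⟨r, rfl⟩ := hm
      omega
    by_cases hclosed : IsClosedAt π a
    · refine squeeze_zero' (Eventually.of_forall fun N => by unfold Vval; positivity) ?_
        (hbad a fun hg => hna ⟨hclosed, hg⟩)
      filter_upwards [eventually_gt_atTop 0] with N hN
      have hle := pairCount_le_jcount_mul hinv hfix ha hclosed (hpair N)
      rw [Nat.card_fin] at hle
      have hN' : (0 : ℝ) < N := Nat.cast_pos.2 hN
      rw [Vval, div_le_div_iff₀ (by positivity) (by positivity)]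
      calc (pairCount m π (σ N) : ℝ) * (N : ℝ) ^ 2
          ≤ (jcount (σ N a) (σ N (π a)) * (N : ℝ) ^ (m / 2 - 1)) * (N : ℝ) ^ 2 := by
            gcongr
            exact_mod_cast hle
        _ = jcount (σ N a) (σ N (π a)) * (N : ℝ) ^ (m / 2 + 1) := by
            rw [mul_assoc, ← pow_add]
            congr 2
            omega
    · refine squeeze_zero' (Eventually.of_forall fun N => by unfold Vval; positivity) ?_
        tendsto_inv_atTop_nhds_zero_nat
      filter_upwards [eventually_gt_atTop 0] with N hN
      have hle := pairCount_le_of_not_isClosedAt hinv hfix hclosed (hpair N)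
      rw [Nat.card_fin] at hle
      have hN' : (0 : ℝ) < N := Nat.cast_pos.2 hN
      rw [Vval, div_le_iff₀ (by positivity), pow_succ', inv_mul_cancel_left₀ hN'.ne']
      exact_mod_cast hle
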